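/- arXiv:2302.01160 — 12 statements merged into one kernel-verified Lean document; each statement's English description precedes it below -/
import Mathlib

section
/- Let τ > 0, let f : ℝ → ℝ be τ-periodic, of bounded variation on [−τ, 0] and continuous from the right, and let λ ∈ ℝ be in the range of f, i.e., λ = f(θ̂) for some θ̂ ∈ [−τ, 0). Then the map Y → Y, φ ↦ (f − λ)·φ, is not surjective: there exists ψ ∈ Y such that no φ ∈ Y satisfies (f(θ) − λ) φ(θ) = ψ(θ) for all θ ∈ [−τ, 0]. -/
/-- Membership in the state space `Y = NBV([-τ,0]; ℝ)`. -/
def memY (τ : ℝ) (φ : ℝ → ℝ) : Prop :=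
  BoundedVariationOn φ (Set.Icc (-τ) 0) ∧
  (∀ θ ∈ Set.Ico (-τ) 0, ContinuousWithinAt φ (Set.Ici θ) θ) ∧
  φ 0 = 0

/-- The indicator of the negative half-line is an element of `Y`. -/
lemma memY_indicator_Iio (τ : ℝ) :
    memY τ ((Set.Iio (0 : ℝ)).indicator 1) := by
  refine ⟨?_, fun θ hθ => ?_, by simp⟩
  · have hanti : AntitoneOn ((Set.Iio (0 : ℝ)).indicator (1 : ℝ → ℝ)) (Set.Icc (-τ) 0) := by
      intro x _ y _ hxy
      simp only [Set.indicator_apply, Set.mem_Iio, Pi.one_apply]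
      split_ifs <;> linarith
    have hneg := hanti.neg.boundedVariationOn (C := 1) fun x _ => by
      simp only [Set.indicator_apply, Pi.one_apply]
      split_ifs <;> simp
    simpa [Function.comp_def] using
      LipschitzWith.comp_boundedVariationOn (LipschitzWith.id (α := ℝ)).neg hneg
  · refine ContinuousAt.continuousWithinAt ((continuousAt_const (y := (1 : ℝ))).congr ?_)
    filter_upwards [Iio_mem_nhds hθ.2] with x hx
    simp [Set.indicator_of_mem hx]

/-- If `λ` is in the range of `f`, say `λ = f θ̂` with
`θ̂ ∈ [-τ, 0)`, then the map `φ ↦ (f - λ)·φ` on `Y` is not surjective. -/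
theorem not_surjective_of_mem_range
    (τ : ℝ) (hτ : 0 < τ) (f : ℝ → ℝ) (hf : Function.Periodic f τ)
    (hbv : BoundedVariationOn f (Set.Icc (-τ) 0))
    (hrc : ∀ θ ∈ Set.Ico (-τ) 0, ContinuousWithinAt f (Set.Ici θ) θ)
    (lam : ℝ) (θhat : ℝ) (hθhat : θhat ∈ Set.Ico (-τ) 0) (hlam : lam = f θhat) :
    ∃ ψ : ℝ → ℝ, memY τ ψ ∧
      ¬ ∃ φ : ℝ → ℝ, memY τ φ ∧ ∀ θ ∈ Set.Icc (-τ) 0, (f θ - lam) * φ θ = ψ θ := by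
  refine ⟨_, memY_indicator_Iio τ, ?_⟩
  rintro ⟨φ, -, h⟩
  have := h θhat ⟨hθhat.1, hθhat.2.le⟩
  simp [hlam, Set.indicator_of_mem (Set.mem_Iio.2 hθhat.2)] at this
end

section
/- Let τ > 0, let f : ℝ → ℝ be τ-periodic, of bounded variation on [−τ, 0] and continuous from the right, and let λ ∈ ℝ be in the closure of the range of f but not in the range of f (i.e., λ ∈ closure(f(ℝ)) \ f(ℝ)). Then the map Y → Y, φ ↦ (f − λ)·φ, is not surjective: there exists ψ ∈ Y such that no φ ∈ Y satisfies (f(θ) − λ) φ(θ) = ψ(θ) for all θ ∈ [−τ, 0]. -/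
theorem memY_ite_neg (τ : ℝ) : memY τ (fun θ => if θ < 0 then -1 else 0) := by
  refine ⟨MonotoneOn.boundedVariationOn (C := 1) ?_ ?_, ?_, by simp⟩
  · intro x _ y _ hxy
    dsimp only
    split_ifs <;> linarith
  · intro x _
    split_ifs <;> simp
  · intro θ hθ
    refine ContinuousAt.continuousWithinAt ?_
    refine (continuousAt_const (y := (-1 : ℝ))).congr ?_
    filter_upwards [Iio_mem_nhds hθ.2] with x hx
    exact (if_pos hx).symm

/-- If `λ ∈ closure (f(ℝ)) \ f(ℝ)`, then the map `φ ↦ (f - λ)·φ`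
on `Y` is not surjective. -/
theorem not_surjective_of_mem_closure_range_diff_range
    (τ : ℝ) (hτ : 0 < τ) (f : ℝ → ℝ) (hf : Function.Periodic f τ)
    (hbv : BoundedVariationOn f (Set.Icc (-τ) 0))
    (hrc : ∀ θ ∈ Set.Ico (-τ) 0, ContinuousWithinAt f (Set.Ici θ) θ)
    (lam : ℝ) (hlam : lam ∈ closure (Set.range f) \ Set.range f) :
    ∃ ψ : ℝ → ℝ, memY τ ψ ∧
      ¬ ∃ φ : ℝ → ℝ, memY τ φ ∧ ∀ θ ∈ Set.Icc (-τ) 0, (f θ - lam) * φ θ = ψ θ := by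
  refine ⟨_, memY_ite_neg τ, ?_⟩
  rintro ⟨φ, ⟨hφ, -, hφ0⟩, heq⟩
  obtain ⟨M, hM0, hM⟩ : ∃ M : ℝ, 0 ≤ M ∧ ∀ θ ∈ Set.Icc (-τ) 0, |φ θ| ≤ M := by
    refine ⟨(eVariationOn φ (Set.Icc (-τ) 0)).toReal, ENNReal.toReal_nonneg, fun θ hθ => ?_⟩
    have h := hφ.dist_le hθ (Set.right_mem_Icc.2 (by linarith))
    rwa [hφ0, Real.dist_eq, sub_zero] at h
  obtain ⟨_, ⟨x, rfl⟩, hx⟩ := Metric.mem_closure_iff.1 hlam.1 (1 / (M + 1)) (by positivity)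
  obtain ⟨y, hy, hxy⟩ := hf.exists_mem_Ico hτ x (-τ)
  rw [neg_add_cancel] at hy
  rw [hxy, dist_comm, Real.dist_eq, lt_div_iff₀ (by positivity)] at hx
  have hyI := Set.Ico_subset_Icc_self hy
  have h := congrArg abs (heq y hyI)
  simp only [if_pos hy.2, abs_mul, abs_neg, abs_one] at h
  nlinarith [mul_le_mul_of_nonneg_left (hM y hyI) (abs_nonneg (f y - lam)),
    abs_nonneg (f y - lam)]
end

section
/- Let τ > 0, let f : ℝ → ℝ be τ-periodic, of bounded variation on [−τ, 0] and continuous from the right, and let λ ∈ ℝ with λ not in the closure of the range of f. Then the map Y → Y, φ ↦ (f − λ)·φ, is bijective: for every ψ ∈ Y there exists a unique φ ∈ Y with (f(θ) − λ) φ(θ) = ψ(θ) for all θ ∈ [−τ, 0]. -/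
open scoped NNReal in
/-- Translated inversion is Lipschitz away from the pole. -/
lemma lipschitzOnWith_inv_sub_of_le_dist {δ : ℝ≥0} (hδ : 0 < δ) (a : ℝ) :
    LipschitzOnWith (δ⁻¹ ^ 2) (fun x : ℝ => (x - a)⁻¹) {x | (δ : ℝ) ≤ dist a x} := by
  have hδ' : (0 : ℝ) < δ := hδ
  refine LipschitzOnWith.of_dist_le_mul fun x hx y hy => ?_
  simp only [Set.mem_ofPred_eq, Real.dist_eq, abs_sub_comm a] at hx hy
  have hx0 : x - a ≠ 0 := abs_pos.mp (hδ'.trans_le hx)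
  have hy0 : y - a ≠ 0 := abs_pos.mp (hδ'.trans_le hy)
  have hprod : (δ : ℝ) ^ 2 ≤ |x - a| * |y - a| := by
    rw [sq]
    exact mul_le_mul hx hy hδ'.le (abs_nonneg _)
  rw [Real.dist_eq, Real.dist_eq, inv_sub_inv hx0 hy0, abs_div, abs_mul, sub_sub_sub_cancel_right,
    abs_sub_comm y x, div_eq_inv_mul]
  push_cast
  rw [inv_pow]
  gcongr

/-- The reciprocal of `f - a` has bounded variation if `f` does and stays away from `a`. -/
lemma BoundedVariationOn.inv_sub_const {α : Type*} [LinearOrder α] {f : α → ℝ} {s : Set α}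
    (hf : BoundedVariationOn f s) {a : ℝ} (ha : a ∉ closure (f '' s)) :
    BoundedVariationOn (fun x => (f x - a)⁻¹) s := by
  simp only [Metric.mem_closure_iff, not_forall, not_exists, not_and, not_lt] at ha
  obtain ⟨δ, hδ, hle⟩ := ha
  lift δ to NNReal using hδ.le
  exact (lipschitzOnWith_inv_sub_of_le_dist (NNReal.coe_pos.mp hδ) a).comp_boundedVariationOn
    (fun x hx => hle _ (Set.mem_image_of_mem f hx)) hf

/-- If `λ ∈ ℝ` is not in the closure of the range of `f`, then the
map `φ ↦ (f - λ)·φ` on `Y` is bijective: every `ψ ∈ Y` has a unique preimage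
(uniqueness meaning agreement on `[-τ, 0]`). -/
theorem bijective_of_not_mem_closure_range
    (τ : ℝ) (hτ : 0 < τ) (f : ℝ → ℝ) (hf : Function.Periodic f τ)
    (hbv : BoundedVariationOn f (Set.Icc (-τ) 0))
    (hrc : ∀ θ ∈ Set.Ico (-τ) 0, ContinuousWithinAt f (Set.Ici θ) θ)
    (lam : ℝ) (hlam : lam ∉ closure (Set.range f)) :
    ∀ ψ : ℝ → ℝ, memY τ ψ →
      (∃ φ : ℝ → ℝ, memY τ φ ∧ ∀ θ ∈ Set.Icc (-τ) 0, (f θ - lam) * φ θ = ψ θ) ∧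
      (∀ φ₁ φ₂ : ℝ → ℝ, memY τ φ₁ → memY τ φ₂ →
        (∀ θ ∈ Set.Icc (-τ) 0, (f θ - lam) * φ₁ θ = ψ θ) →
        (∀ θ ∈ Set.Icc (-τ) 0, (f θ - lam) * φ₂ θ = ψ θ) →
        ∀ θ ∈ Set.Icc (-τ) 0, φ₁ θ = φ₂ θ) := by
  have hne (θ : ℝ) : f θ - lam ≠ 0 := fun h =>
    hlam (subset_closure ⟨θ, sub_eq_zero.mp h⟩)
  rintro ψ ⟨hψbv, hψrc, hψ0⟩
  refine ⟨⟨fun θ => (f θ - lam)⁻¹ * ψ θ, ⟨?_, fun θ hθ => ?_, by simp [hψ0]⟩,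
    fun θ _ => mul_inv_cancel_left₀ (hne θ) _⟩, fun φ₁ φ₂ _ _ h₁ h₂ θ hθ => ?_⟩
  · exact (hbv.inv_sub_const
      fun h => hlam (closure_mono (Set.image_subset_range f _) h)).fun_mul hψbv
  · exact (((hrc θ hθ).sub continuousWithinAt_const).inv₀ (hne θ)).mul (hψrc θ hθ)
  · exact mul_left_cancel₀ (hne θ) ((h₁ θ hθ).trans (h₂ θ hθ).symm)
end

section
/- Let τ > 0, let f : ℝ → ℝ be τ-periodic, of bounded variation on [−τ, 0] and continuous from the right, and let λ ∈ ℂ with nonzero imaginary part. Then the map Y_ℂ → Y_ℂ, φ ↦ (f − λ)·φ, is bijective: for every ψ ∈ Y_ℂ there exists a unique φ ∈ Y_ℂ with (f(θ) − λ) φ(θ) = ψ(θ) for all θ ∈ [−τ, 0]. -/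
/-- Membership in the complexified state space `Y_ℂ = NBV([-τ,0]; ℂ)`. -/
def memYC (τ : ℝ) (φ : ℝ → ℂ) : Prop :=
  BoundedVariationOn φ (Set.Icc (-τ) 0) ∧
  (∀ θ ∈ Set.Ico (-τ) 0, ContinuousWithinAt φ (Set.Ici θ) θ) ∧
  φ 0 = 0

theorem abs_im_le_norm_ofReal_sub (lam : ℂ) (x : ℝ) : |lam.im| ≤ ‖(x : ℂ) - lam‖ := by
  simpa using Complex.abs_im_le_norm ((x : ℂ) - lam)

theorem ofReal_sub_ne_zero {lam : ℂ} (hlam : lam.im ≠ 0) (x : ℝ) : (x : ℂ) - lam ≠ 0 :=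
  norm_pos_iff.mp ((abs_pos.mpr hlam).trans_le (abs_im_le_norm_ofReal_sub lam x))

/-- For non-real `lam`, the resolvent function `x ↦ (x - lam)⁻¹` is Lipschitz on the real line. -/
theorem lipschitzWith_resolvent {lam : ℂ} (hlam : lam.im ≠ 0) :
    LipschitzWith (Real.toNNReal ((|lam.im| * |lam.im|)⁻¹)) fun x : ℝ => ((x : ℂ) - lam)⁻¹ := by
  have him : 0 < |lam.im| := abs_pos.mpr hlam
  refine LipschitzWith.of_dist_le_mul fun x y => ?_
  rw [dist_inv_inv₀ (ofReal_sub_ne_zero hlam x) (ofReal_sub_ne_zero hlam y), dist_sub_right,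
    Complex.isometry_ofReal.dist_eq, Real.coe_toNNReal _ (by positivity), div_eq_inv_mul]
  gcongr <;> exact abs_im_le_norm_ofReal_sub lam _

/-- If `λ ∈ ℂ` has nonzero imaginary part, then the map
`φ ↦ (f - λ)·φ` on `Y_ℂ` is bijective: every `ψ ∈ Y_ℂ` has a unique preimage
(uniqueness meaning agreement on `[-τ, 0]`). -/
theorem bijective_of_im_ne_zero
    (τ : ℝ) (hτ : 0 < τ) (f : ℝ → ℝ) (hf : Function.Periodic f τ)
    (hbv : BoundedVariationOn f (Set.Icc (-τ) 0))
    (hrc : ∀ θ ∈ Set.Ico (-τ) 0, ContinuousWithinAt f (Set.Ici θ) θ)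
    (lam : ℂ) (hlam : lam.im ≠ 0) :
    ∀ ψ : ℝ → ℂ, memYC τ ψ →
      (∃ φ : ℝ → ℂ, memYC τ φ ∧ ∀ θ ∈ Set.Icc (-τ) 0, ((f θ : ℂ) - lam) * φ θ = ψ θ) ∧
      (∀ φ₁ φ₂ : ℝ → ℂ, memYC τ φ₁ → memYC τ φ₂ →
        (∀ θ ∈ Set.Icc (-τ) 0, ((f θ : ℂ) - lam) * φ₁ θ = ψ θ) →
        (∀ θ ∈ Set.Icc (-τ) 0, ((f θ : ℂ) - lam) * φ₂ θ = ψ θ) →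
        ∀ θ ∈ Set.Icc (-τ) 0, φ₁ θ = φ₂ θ) := by
  have hne : ∀ θ, (f θ : ℂ) - lam ≠ 0 := fun θ => ofReal_sub_ne_zero hlam (f θ)
  rintro ψ ⟨hψbv, hψrc, hψ0⟩
  refine ⟨⟨fun θ => ((f θ : ℂ) - lam)⁻¹ * ψ θ, ⟨?_, ?_, ?_⟩, ?_⟩, ?_⟩
  · exact ((lipschitzWith_resolvent hlam).comp_boundedVariationOn hbv).smul hψbv
  · intro θ hθ
    have hfθ := Complex.continuous_ofReal.continuousAt.comp_continuousWithinAt (hrc θ hθ)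
    exact ((hfθ.sub continuousWithinAt_const).inv₀ (hne θ)).mul (hψrc θ hθ)
  · simp [hψ0]
  · exact fun θ _ => mul_inv_cancel_left₀ (hne θ) _
  · exact fun φ₁ φ₂ _ _ h₁ h₂ θ hθ =>
      mul_left_cancel₀ (hne θ) ((h₁ θ hθ).trans (h₂ θ hθ).symm)
end

section
/- Let τ > 0, let f : ℝ → ℝ be τ-periodic, of bounded variation on [−τ, 0] and continuous from the right, and let λ ∈ ℂ. The map Y_ℂ → Y_ℂ, φ ↦ (f − λ)·φ, is bijective if and only if λ does not belong to the closure of the range of f (regarded as a subset of ℂ). In other words, the spectrum of the complexified monodromy operator is exactly closure(f(ℝ)) and its resolvent set is ℂ \ closure(f(ℝ)). -/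
open Set

/-- Inversion of `r - z`, `r` real, is Lipschitz away from `z`. -/
lemma lipschitzOnWith_inv_ofReal_sub (z : ℂ) {δ : ℝ} (hδ : 0 < δ) :
    LipschitzOnWith (δ ^ 2)⁻¹.toNNReal (fun r : ℝ => ((r : ℂ) - z)⁻¹)
      {r : ℝ | δ ≤ ‖(r : ℂ) - z‖} := by
  refine LipschitzOnWith.of_dist_le_mul fun x hx y hy => ?_
  have hx' : δ ≤ ‖(x : ℂ) - z‖ := hx
  have hy' : δ ≤ ‖(y : ℂ) - z‖ := hy
  rw [dist_inv_inv₀ (norm_pos_iff.mp (hδ.trans_le hx')) (norm_pos_iff.mp (hδ.trans_le hy')),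
    dist_sub_right, Complex.dist_of_im_eq (by simp), Real.coe_toNNReal _ (by positivity),
    Complex.ofReal_re, Complex.ofReal_re, div_eq_inv_mul, sq]
  gcongr

/-- The indicator function of `(-∞, 0)` belongs to `Y_ℂ`. -/
lemma memYC_indicator_Iio (τ : ℝ) : memYC τ ((Iio 0).indicator 1) := by
  refine ⟨?_, fun θ hθ => ?_, by simp⟩
  · have hmono : Monotone fun θ : ℝ => if θ < 0 then (-1 : ℝ) else 0 := by
      intro a b hab
      dsimp only
      split_ifs <;> linarith
    have hbv := (hmono.monotoneOn (Icc (-τ) 0)).boundedVariationOn (C := 1)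
      fun x _ => by split_ifs <;> simp
    have hlip : LipschitzWith 1 fun r : ℝ => ((-r : ℝ) : ℂ) :=
      LipschitzWith.of_dist_le_mul fun x y => by
        rw [Complex.dist_of_im_eq (by simp)]
        simp
    convert hlip.comp_boundedVariationOn hbv using 1
    ext θ
    by_cases h : θ < 0 <;> simp [h]
  · refine ContinuousAt.continuousWithinAt ?_
    refine (continuousAt_const (y := (1 : ℂ))).congr ?_
    filter_upwards [Iio_mem_nhds hθ.2] with x hx
    simp [indicator_of_mem hx]

/-- The map `φ ↦ (f - λ)·φ` on `Y_ℂ` is bijective (surjective onto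
`Y_ℂ` and injective, modulo agreement on `[-τ, 0]`) if and only if `λ` is not in
the closure of the range of `f` regarded as a subset of `ℂ`: the spectrum of the
complexified monodromy operator is exactly `closure (f(ℝ))`. -/
theorem spectrum_eq_closure_range
    (τ : ℝ) (hτ : 0 < τ) (f : ℝ → ℝ) (hf : Function.Periodic f τ)
    (hbv : BoundedVariationOn f (Set.Icc (-τ) 0))
    (hrc : ∀ θ ∈ Set.Ico (-τ) 0, ContinuousWithinAt f (Set.Ici θ) θ)
    (lam : ℂ) :
    ((∀ ψ : ℝ → ℂ, memYC τ ψ →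
        ∃ φ : ℝ → ℂ, memYC τ φ ∧ ∀ θ ∈ Set.Icc (-τ) 0, ((f θ : ℂ) - lam) * φ θ = ψ θ) ∧
     (∀ φ₁ φ₂ : ℝ → ℂ, memYC τ φ₁ → memYC τ φ₂ →
        (∀ θ ∈ Set.Icc (-τ) 0, ((f θ : ℂ) - lam) * φ₁ θ = ((f θ : ℂ) - lam) * φ₂ θ) →
        ∀ θ ∈ Set.Icc (-τ) 0, φ₁ θ = φ₂ θ)) ↔
    lam ∉ closure (Set.range (fun t : ℝ => (f t : ℂ))) := by
  have hper (t : ℝ) : ∃ θ ∈ Ico (-τ) 0, f t = f θ := by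
    simpa using hf.exists_mem_Ico hτ t (-τ)
  constructor
  · rintro ⟨hsurj, -⟩ hlam
    obtain ⟨φ, ⟨hφ, -, hφ0⟩, hφeq⟩ := hsurj _ (memYC_indicator_Iio τ)
    set M := (eVariationOn φ (Icc (-τ) 0)).toReal
    have hM : 0 ≤ M := ENNReal.toReal_nonneg
    obtain ⟨_, ⟨t, rfl⟩, ht⟩ := Metric.mem_closure_iff.mp hlam (M + 1)⁻¹ (by positivity)
    obtain ⟨θ, hθ, hfθ⟩ := hper t
    have hbound : ‖φ θ‖ ≤ M := by
      simpa [hφ0] using hφ.dist_le (Ico_subset_Icc_self hθ) (right_mem_Icc.mpr (by linarith))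
    have hprod : ‖(f θ : ℂ) - lam‖ * ‖φ θ‖ = 1 := by
      rw [← norm_mul, hφeq θ (Ico_subset_Icc_self hθ), indicator_of_mem (mem_Iio.mpr hθ.2)]
      simp
    dsimp only at ht
    rw [dist_comm, dist_eq_norm, hfθ, lt_inv_comm₀ ?_ (by positivity)] at ht
    · rw [← eq_inv_of_mul_eq_one_right hprod] at ht
      linarith
    · exact norm_pos_iff.mpr fun h => by simp [h] at hprod
  · intro hlam
    obtain ⟨δ, hδ, hdist⟩ : ∃ δ > 0, ∀ t, δ ≤ ‖(f t : ℂ) - lam‖ := by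
      simpa [Metric.mem_closure_iff, dist_comm lam, dist_eq_norm] using hlam
    have hne (t : ℝ) : (f t : ℂ) - lam ≠ 0 := norm_pos_iff.mp (hδ.trans_le (hdist t))
    refine ⟨fun ψ ⟨hψ, hψc, hψ0⟩ => ⟨fun θ => ((f θ : ℂ) - lam)⁻¹ * ψ θ, ⟨?_, ?_, ?_⟩, ?_⟩, ?_⟩
    · exact ((lipschitzOnWith_inv_ofReal_sub lam hδ).comp_boundedVariationOn
        (fun t _ => hdist t) hbv).smul hψ
    · intro θ hθ
      have hfc : ContinuousWithinAt (fun t => (f t : ℂ)) (Ici θ) θ :=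
        Complex.continuous_ofReal.continuousAt.comp_continuousWithinAt (hrc θ hθ)
      exact ((hfc.sub continuousWithinAt_const).inv₀ (hne θ)).mul (hψc θ hθ)
    · simp [hψ0]
    · exact fun θ _ => mul_inv_cancel_left₀ (hne θ) _
    · exact fun φ₁ φ₂ _ _ h θ hθ => mul_left_cancel₀ (hne θ) (h θ hθ)
end

section
/- Let τ > 0, let f : ℝ → ℝ be τ-periodic, of bounded variation on [−τ, 0] and continuous from the right, and let λ ∈ ℂ. There exists φ ∈ Y_ℂ which is not identically zero on [−τ, 0] and satisfies f(θ) φ(θ) = λ φ(θ) for all θ ∈ [−τ, 0] (i.e., λ is an eigenvalue of the complexified monodromy operator) if and only if there exist real numbers a < b with [a, b) ⊆ [−τ, 0) such that f(θ) = λ for all θ ∈ [a, b) (i.e., the preimage f⁻¹(λ) contains a segment, equivalently has nonempty interior). -/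
theorem monotone_indicator_Ici_one (a : ℝ) :
    Monotone ((Set.Ici a).indicator (1 : ℝ → ℝ)) := by
  intro x y hxy
  by_cases hx : a ≤ x
  · simp [Set.indicator, hx, hx.trans hxy]
  · simp only [Set.indicator, Set.mem_Ici, hx, if_false]
    split_ifs <;> simp

/-- The indicator of `[a, b)` is a tent function composed with a two-step staircase. -/
theorem boundedVariationOn_indicator_Ico {a b : ℝ} (hab : a ≤ b) (s : Set ℝ) :
    BoundedVariationOn ((Set.Ico a b).indicator (1 : ℝ → ℂ)) s := by
  set g : ℝ → ℝ := (Set.Ici a).indicator 1 + (Set.Ici b).indicator 1 with hg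
  have hbv : BoundedVariationOn g s := by
    refine (((monotone_indicator_Ici_one a).add
      (monotone_indicator_Ici_one b)).monotoneOn s).boundedVariationOn (C := 2) fun x _ => ?_
    simp only [hg, Pi.add_apply, Set.indicator, Pi.one_apply]
    split_ifs <;> norm_num
  have heq : (Set.Ico a b).indicator (1 : ℝ → ℂ) =
      (fun t : ℝ => ((1 - |t - 1| : ℝ) : ℂ)) ∘ g := by
    funext x
    rcases lt_or_ge x a with ha | ha
    · simp [hg, Set.indicator, ha.not_ge, (ha.trans_le hab).not_ge]
    · rcases lt_or_ge x b with hb | hb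
      · simp [hg, Set.indicator, ha, hb, hb.not_ge]
      · simp [hg, Set.indicator, ha, hb, hb.not_gt]
  have hlip : LipschitzWith 1 (fun t : ℝ => ((1 - |t - 1| : ℝ) : ℂ)) := by
    refine LipschitzWith.of_dist_le_mul fun x y => ?_
    rw [Complex.isometry_ofReal.dist_eq, Real.dist_eq, Real.dist_eq, NNReal.coe_one, one_mul,
      sub_sub_sub_cancel_left]
    refine (abs_abs_sub_abs_le _ _).trans_eq ?_
    rw [sub_sub_sub_cancel_right, abs_sub_comm]
  rw [heq]
  exact hlip.comp_boundedVariationOn hbv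

theorem continuousWithinAt_Ici_indicator_Ico (a b θ : ℝ) :
    ContinuousWithinAt ((Set.Ico a b).indicator (1 : ℝ → ℂ)) (Set.Ici θ) θ := by
  have key : ∀ᶠ x in nhdsWithin θ (Set.Ici θ), (x ∈ Set.Ico a b ↔ θ ∈ Set.Ico a b) := by
    have h (c : ℝ) : ∀ᶠ x in nhdsWithin θ (Set.Ici θ), (c ≤ x ↔ c ≤ θ) := by
      rcases le_or_gt c θ with hc | hc
      · filter_upwards [self_mem_nhdsWithin] with x hx
        exact iff_of_true (hc.trans hx) hc
      · filter_upwards [Ico_mem_nhdsGE hc] with x hx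
        exact iff_of_false hx.2.not_ge hc.not_ge
    filter_upwards [h a, h b] with x ha hb
    rw [Set.mem_Ico, Set.mem_Ico, ha, ← not_le, hb, not_le]
  refine tendsto_const_nhds.congr' ?_
  filter_upwards [key] with x hx
  by_cases hθ : θ ∈ Set.Ico a b
  · simp [hθ, hx.2 hθ]
  · simp [hθ, mt hx.1 hθ]

/-- `λ` is an eigenvalue of the complexified monodromy operator
(i.e. there is `φ ∈ Y_ℂ`, not identically zero on `[-τ,0]`, with
`f·φ = λ·φ` on `[-τ,0]`) if and only if `f⁻¹(λ)` contains a segment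
`[a, b) ⊆ [-τ, 0)`. -/
theorem eigenvalue_iff_preimage_contains_segment
    (τ : ℝ) (hτ : 0 < τ) (f : ℝ → ℝ) (hf : Function.Periodic f τ)
    (hbv : BoundedVariationOn f (Set.Icc (-τ) 0))
    (hrc : ∀ θ ∈ Set.Ico (-τ) 0, ContinuousWithinAt f (Set.Ici θ) θ)
    (lam : ℂ) :
    (∃ φ : ℝ → ℂ, memYC τ φ ∧ (∃ θ ∈ Set.Icc (-τ) 0, φ θ ≠ 0) ∧
      ∀ θ ∈ Set.Icc (-τ) 0, (f θ : ℂ) * φ θ = lam * φ θ) ↔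
    (∃ a b : ℝ, a < b ∧ Set.Ico a b ⊆ Set.Ico (-τ) 0 ∧
      ∀ θ ∈ Set.Ico a b, (f θ : ℂ) = lam) := by
  constructor
  · rintro ⟨φ, ⟨-, hφ, hφ0⟩, ⟨θ, hθ, hne⟩, heq⟩
    have hθ0 : θ < 0 := lt_of_le_of_ne hθ.2 (by rintro rfl; exact hne hφ0)
    obtain ⟨u, hu, hsub⟩ := (mem_nhdsGE_iff_exists_Ico_subset' hθ0).1
      ((hφ θ ⟨hθ.1, hθ0⟩).eventually_ne hne)
    have hmem : Set.Ico θ (min u 0) ⊆ Set.Ico (-τ) 0 :=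
      Set.Ico_subset_Ico hθ.1 (min_le_right _ _)
    refine ⟨θ, min u 0, lt_min hu hθ0, hmem, fun x hx => ?_⟩
    exact mul_right_cancel₀ (hsub ⟨hx.1, hx.2.trans_le (min_le_left _ _)⟩)
      (heq x (Set.Ico_subset_Icc_self (hmem hx)))
  · rintro ⟨a, b, hab, hsub, hfl⟩
    have hb : b ≤ 0 := ((Set.Ico_subset_Ico_iff hab).1 hsub).2
    refine ⟨(Set.Ico a b).indicator 1, ⟨boundedVariationOn_indicator_Ico hab.le _,
      fun θ _ => continuousWithinAt_Ici_indicator_Ico a b θ, ?_⟩,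
      ⟨a, Set.Ico_subset_Icc_self (hsub ⟨le_rfl, hab⟩), ?_⟩, fun θ _ => ?_⟩
    · exact Set.indicator_of_notMem (fun h => hb.not_gt h.2) _
    · simp [hab]
    · by_cases hx : θ ∈ Set.Ico a b
      · rw [hfl θ hx]
      · simp [Set.indicator_of_notMem hx]
end

section
/- Let τ > 0, let f : ℝ → ℝ be τ-periodic, of bounded variation on [−τ, 0] and continuous from the right, let θ̂ ∈ [−τ, 0) and set λ = f(θ̂). Then for every ψ ∈ Y_ℂ with ψ(θ̂) ≠ 0 and every φ ∈ Y_ℂ, the total variation of the function ψ − (f − λ)·φ on [−τ, 0] is at least |ψ(θ̂)|. Consequently, the range of the map φ ↦ (f − λ)·φ is not dense in Y_ℂ with respect to the total variation norm. -/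
/-- The inclusion `ℝ → ℂ` belongs to `Y_ℂ`. -/
theorem memYC_ofReal (τ : ℝ) : memYC τ (fun θ : ℝ => (θ : ℂ)) := by
  refine ⟨?_, fun θ _ => Complex.continuous_ofReal.continuousWithinAt, by simp⟩
  have hid : BoundedVariationOn (fun θ : ℝ => θ) (Set.Icc (-τ) 0) := by
    rcases lt_or_ge 0 (-τ) with h | h
    · simp [BoundedVariationOn, Set.Icc_eq_empty_of_lt h, eVariationOn.subsingleton]
    · have := (monotone_id.monotoneOn (Set.Icc (-τ) (0 : ℝ))).locallyBoundedVariationOn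
        (-τ) 0 ⟨le_rfl, h⟩ ⟨h, le_rfl⟩
      rwa [Set.inter_self] at this
  exact Complex.isometry_ofReal.lipschitz.comp_boundedVariationOn hid

/-- The variation of `ψ - (f - f θ₀) φ` dominates `‖ψ θ₀‖` when `ψ` and `φ` vanish at `0`. -/
theorem ofReal_norm_le_eVariationOn_sub_mul {τ θ₀ : ℝ} (hθ₀ : θ₀ ∈ Set.Ico (-τ) 0) (f : ℝ → ℝ)
    {ψ φ : ℝ → ℂ} (hψ : ψ 0 = 0) (hφ : φ 0 = 0) :
    ENNReal.ofReal ‖ψ θ₀‖ ≤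
      eVariationOn (fun θ => ψ θ - ((f θ : ℂ) - (f θ₀ : ℂ)) * φ θ) (Set.Icc (-τ) 0) := by
  have h := eVariationOn.edist_le (fun θ => ψ θ - ((f θ : ℂ) - (f θ₀ : ℂ)) * φ θ)
    (s := Set.Icc (-τ) 0) (x := θ₀) (y := 0) ⟨hθ₀.1, hθ₀.2.le⟩ ⟨hθ₀.1.trans hθ₀.2.le, le_rfl⟩
  simpa [hψ, hφ, edist_dist, dist_eq_norm] using h

/-- For `λ = f θ̂` with `θ̂ ∈ [-τ, 0)`, every `ψ ∈ Y_ℂ` with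
`ψ θ̂ ≠ 0` is at total-variation distance at least `|ψ θ̂|` from the range of
`φ ↦ (f - λ)·φ`; consequently this range is not dense in `Y_ℂ`. -/
theorem range_not_dense_at_point_of_range
    (τ : ℝ) (hτ : 0 < τ) (f : ℝ → ℝ) (hf : Function.Periodic f τ)
    (hbv : BoundedVariationOn f (Set.Icc (-τ) 0))
    (hrc : ∀ θ ∈ Set.Ico (-τ) 0, ContinuousWithinAt f (Set.Ici θ) θ)
    (θhat : ℝ) (hθhat : θhat ∈ Set.Ico (-τ) 0) (lam : ℝ) (hlam : lam = f θhat) :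
    (∀ ψ : ℝ → ℂ, memYC τ ψ → ψ θhat ≠ 0 → ∀ φ : ℝ → ℂ, memYC τ φ →
      ENNReal.ofReal ‖ψ θhat‖ ≤
        eVariationOn (fun θ => ψ θ - ((f θ : ℂ) - (lam : ℂ)) * φ θ) (Set.Icc (-τ) 0)) ∧
    (∃ ψ : ℝ → ℂ, memYC τ ψ ∧ ∃ δ : ℝ, 0 < δ ∧ ∀ φ : ℝ → ℂ, memYC τ φ →
      ENNReal.ofReal δ ≤
        eVariationOn (fun θ => ψ θ - ((f θ : ℂ) - (lam : ℂ)) * φ θ) (Set.Icc (-τ) 0)) := by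
  subst hlam
  refine ⟨fun ψ hψ _ φ hφ => ofReal_norm_le_eVariationOn_sub_mul hθhat f hψ.2.2 hφ.2.2,
    fun θ : ℝ => (θ : ℂ), memYC_ofReal τ, ‖(θhat : ℂ)‖, ?_, fun φ hφ => ?_⟩
  · simpa using hθhat.2.ne
  · exact ofReal_norm_le_eVariationOn_sub_mul (ψ := fun θ : ℝ => (θ : ℂ)) hθhat f
      (memYC_ofReal τ).2.2 hφ.2.2
end

section
/- Let τ > 0 and let f : ℝ → ℝ be τ-periodic, of bounded variation on [−τ, 0] and continuous from the right. For every λ ∈ ℝ belonging to the closure of the range of f, there exist ψ ∈ Y and δ > 0 such that for every φ ∈ Y the total variation of ψ − (f − λ)·φ on [−τ, 0] is at least δ. In other words, the range of the map φ ↦ (f − λ)·φ is never dense in Y with respect to the total variation norm when λ ∈ closure(f(ℝ)); hence the continuous spectrum of the (complexified) monodromy operator is empty. -/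
/-- For every `λ` in the closure of the range of `f`, the range
of the map `φ ↦ (f - λ)·φ` is not dense in `Y` with respect to the total
variation norm: some `ψ ∈ Y` stays at total-variation distance at least some
`δ > 0` from it. Hence the continuous spectrum of the monodromy operator is
empty. -/
theorem continuous_spectrum_empty
    (τ : ℝ) (hτ : 0 < τ) (f : ℝ → ℝ) (hf : Function.Periodic f τ)
    (hbv : BoundedVariationOn f (Set.Icc (-τ) 0))
    (hrc : ∀ θ ∈ Set.Ico (-τ) 0, ContinuousWithinAt f (Set.Ici θ) θ) :
    ∀ lam : ℝ, lam ∈ closure (Set.range f) →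
      ∃ ψ : ℝ → ℝ, memY τ ψ ∧ ∃ δ : ℝ, 0 < δ ∧ ∀ φ : ℝ → ℝ, memY τ φ →
        ENNReal.ofReal δ ≤
          eVariationOn (fun θ => ψ θ - (f θ - lam) * φ θ) (Set.Icc (-τ) 0) := by
  intro lam hlam
  refine ⟨fun θ => if θ < 0 then -1 else 0, ⟨?_, ?_, by simp⟩, 1 / 2, by norm_num, ?_⟩
  · have hmono : MonotoneOn (fun θ : ℝ => if θ < 0 then (-1 : ℝ) else 0) (Set.Icc (-τ) 0) := by
      intro x _ y _ hxy
      dsimp only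
      split_ifs <;> linarith
    have heq := hmono.eVariationOn_eq (a := -τ) (b := 0)
      (Set.left_mem_Icc.2 (by linarith)) (Set.right_mem_Icc.2 (by linarith))
    rw [Set.inter_self] at heq
    exact heq.trans_ne ENNReal.ofReal_ne_top
  · intro θ hθ
    have heq : (fun θ : ℝ => if θ < 0 then (-1 : ℝ) else 0) =ᶠ[nhds θ] fun _ => -1 := by
      filter_upwards [Iio_mem_nhds hθ.2] with x hx
      exact if_pos hx
    exact (continuousAt_const.congr heq.symm).continuousWithinAt
  · rintro φ ⟨hφ, -, hφ0⟩
    have h0 : (0 : ℝ) ∈ Set.Icc (-τ) 0 := Set.right_mem_Icc.2 (by linarith)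
    set M := (eVariationOn φ (Set.Icc (-τ) 0)).toReal
    have hM0 : 0 ≤ M := ENNReal.toReal_nonneg
    obtain ⟨_, ⟨t, rfl⟩, ht⟩ := Metric.mem_closure_iff.1 hlam (1 / (2 * (M + 1))) (by positivity)
    obtain ⟨θ, hθ, hft⟩ := hf.exists_mem_Ico hτ t (-τ)
    rw [neg_add_cancel] at hθ
    rw [hft, dist_comm, Real.dist_eq, lt_div_iff₀ (by positivity)] at ht
    have hθ' := Set.Ico_subset_Icc_self hθ
    have hbound : |φ θ| ≤ M := by
      simpa [Real.dist_eq, hφ0] using hφ.dist_le hθ' h0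
    refine le_trans ?_ (eVariationOn.edist_le _ hθ' h0)
    rw [edist_dist]
    apply ENNReal.ofReal_le_ofReal
    simp only [Real.dist_eq, if_pos hθ.2, lt_irrefl, if_false, hφ0, mul_zero, sub_zero]
    have hprod : |(f θ - lam) * φ θ| ≤ 1 / 2 := by
      rw [abs_mul]
      nlinarith [mul_le_mul_of_nonneg_left hbound (abs_nonneg (f θ - lam)),
        abs_nonneg (f θ - lam)]
    have hge := neg_abs_le (-1 - (f θ - lam) * φ θ)
    have hge' := neg_abs_le ((f θ - lam) * φ θ)
    linarith
end

section
/- Let τ > 0, let f : ℝ → ℝ be τ-periodic, of bounded variation on [−τ, 0] and continuous from the right, and let λ ∈ ℝ belong to the closure of the range of f. Suppose there is no nonempty open interval contained in [−τ, 0) on which f is constantly equal to λ. Then the map Y → Y, φ ↦ (f − λ)·φ, is injective (any φ ∈ Y with (f − λ)·φ = 0 on [−τ, 0] vanishes identically on [−τ, 0]) and its range is not dense in Y with respect to the total variation norm (there exist ψ ∈ Y and δ > 0 such that the total variation of ψ − (f − λ)·φ on [−τ, 0] is at least δ for every φ ∈ Y). In other words, λ belongs to the residual spectrum of the monodromy operator.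 -/
theorem memY_indicator_Iio_zero (τ : ℝ) : memY τ (Set.indicator (Set.Iio 0) 1) := by
  refine ⟨?_, fun θ hθ => ?_, by simp⟩
  · have hanti : Antitone (Set.indicator (Set.Iio (0 : ℝ)) (1 : ℝ → ℝ)) := by
      intro x y hxy
      by_cases hy : y < 0
      · simp [hy, hxy.trans_lt hy]
      · by_cases hx : x < 0 <;> simp [hx, hy]
    have hneg : BoundedVariationOn (-Set.indicator (Set.Iio (0 : ℝ)) (1 : ℝ → ℝ))
        (Set.Icc (-τ) 0) := by
      refine (hanti.neg.monotoneOn _).boundedVariationOn (C := 1) fun x _ => ?_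
      by_cases hx : x < 0 <;> simp [hx]
    simpa [Function.comp_def] using
      (LipschitzWith.id (α := ℝ)).neg.comp_boundedVariationOn hneg
  · have hev : Set.indicator (Set.Iio (0 : ℝ)) (1 : ℝ → ℝ) =ᶠ[nhds θ] fun _ => 1 := by
      filter_upwards [Iio_mem_nhds hθ.2] with x hx
      exact Set.indicator_of_mem hx 1
    exact (continuousAt_const.congr hev.symm).continuousWithinAt

/-- If a right-continuous `φ` has zero product with `g` and `g` is not identically zero on any
nonempty open subinterval of `[a, b)`, then `φ` vanishes on `[a, b)`. -/
theorem eq_zero_of_mul_eq_zero_of_continuousWithinAt_Ici {a b : ℝ} {g φ : ℝ → ℝ}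
    (hφ : ∀ θ ∈ Set.Ico a b, ContinuousWithinAt φ (Set.Ici θ) θ)
    (hg : ∀ c d : ℝ, c < d → Set.Ioo c d ⊆ Set.Ico a b → ∃ θ ∈ Set.Ioo c d, g θ ≠ 0)
    (hmul : ∀ θ ∈ Set.Ico a b, g θ * φ θ = 0) {θ : ℝ} (hθ : θ ∈ Set.Ico a b) :
    φ θ = 0 := by
  by_contra hne
  obtain ⟨u, hu, hsub⟩ := (mem_nhdsGE_iff_exists_Ico_subset' hθ.2).1
    ((hφ θ hθ).eventually_ne hne)
  have hlt : θ < min u b := lt_min hu hθ.2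
  have hIco : Set.Ioo θ (min u b) ⊆ Set.Ico a b := fun x hx =>
    ⟨hθ.1.trans hx.1.le, hx.2.trans_le (min_le_right _ _)⟩
  obtain ⟨x, hx, hgx⟩ := hg θ (min u b) hlt hIco
  exact mul_ne_zero hgx (hsub ⟨hx.1.le, hx.2.trans_le (min_le_left _ _)⟩) (hmul x (hIco hx))

/-- If `λ ∈ closure (f(ℝ))` and `f` is not constantly `λ` on any
nonempty open interval contained in `[-τ, 0)`, then `φ ↦ (f - λ)·φ` is injective
on `Y` and its range is not dense in `Y` for the total variation norm: `λ` is in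
the residual spectrum of the monodromy operator. -/
theorem residual_spectrum_characterization
    (τ : ℝ) (hτ : 0 < τ) (f : ℝ → ℝ) (hf : Function.Periodic f τ)
    (hbv : BoundedVariationOn f (Set.Icc (-τ) 0))
    (hrc : ∀ θ ∈ Set.Ico (-τ) 0, ContinuousWithinAt f (Set.Ici θ) θ)
    (lam : ℝ) (hlam : lam ∈ closure (Set.range f))
    (hnoseg : ∀ a b : ℝ, a < b → Set.Ioo a b ⊆ Set.Ico (-τ) 0 →
      ∃ θ ∈ Set.Ioo a b, f θ ≠ lam) :
    -- injectivity
    (∀ φ : ℝ → ℝ, memY τ φ →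
      (∀ θ ∈ Set.Icc (-τ) 0, (f θ - lam) * φ θ = 0) →
      ∀ θ ∈ Set.Icc (-τ) 0, φ θ = 0) ∧
    -- range not dense
    (∃ ψ : ℝ → ℝ, memY τ ψ ∧ ∃ δ : ℝ, 0 < δ ∧ ∀ φ : ℝ → ℝ, memY τ φ →
      ENNReal.ofReal δ ≤
        eVariationOn (fun θ => ψ θ - (f θ - lam) * φ θ) (Set.Icc (-τ) 0)) := by
  refine ⟨fun φ hφ hmul θ hθ => ?_, Set.indicator (Set.Iio 0) 1, memY_indicator_Iio_zero τ,
    1 / 2, by norm_num, fun φ hφ => ?_⟩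
  · rcases hθ.2.eq_or_lt with rfl | hθ0
    · exact hφ.2.2
    · exact eq_zero_of_mul_eq_zero_of_continuousWithinAt_Ici (g := fun x => f x - lam) hφ.2.1
        (by simpa only [sub_ne_zero] using hnoseg)
        (fun x hx => hmul x (Set.Ico_subset_Icc_self hx)) ⟨hθ.1, hθ0⟩
  · obtain ⟨hφbv, -, hφ0⟩ := hφ
    set M := (eVariationOn φ (Set.Icc (-τ) 0)).toReal
    have hM : 0 ≤ M := ENNReal.toReal_nonneg
    have h0 : (0 : ℝ) ∈ Set.Icc (-τ) 0 := ⟨by linarith, le_rfl⟩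
    obtain ⟨_, ⟨x, rfl⟩, hx⟩ := Metric.mem_closure_iff.1 hlam (1 / (2 * (M + 1))) (by positivity)
    obtain ⟨t, ht, hxt⟩ := hf.exists_mem_Ico hτ x (-τ)
    rw [neg_add_cancel] at ht
    have htI := Set.Ico_subset_Icc_self ht
    have hφt : |φ t| ≤ M := by simpa [hφ0, Real.dist_eq] using hφbv.dist_le htI h0
    have hft : |f t - lam| ≤ 1 / (2 * (M + 1)) := by
      rw [hxt, dist_comm, Real.dist_eq] at hx
      exact hx.le
    have hsmall : |(f t - lam) * φ t| ≤ 1 / 2 := by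
      rw [abs_mul]
      calc |f t - lam| * |φ t| ≤ 1 / (2 * (M + 1)) * (M + 1) := by
            gcongr; linarith
        _ = 1 / 2 := by field_simp
    refine le_trans ?_ (eVariationOn.edist_le _ htI h0)
    rw [edist_dist, Real.dist_eq]
    refine ENNReal.ofReal_le_ofReal ?_
    rw [Set.indicator_of_mem (Set.mem_Iio.2 ht.2), hφ0]
    simp only [Pi.one_apply, Set.mem_Iio, lt_irrefl, not_false_eq_true,
      Set.indicator_of_notMem, mul_zero, sub_zero]
    exact le_trans (by linarith [le_abs_self ((f t - lam) * φ t)]) (le_abs_self _)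
end

section
/- Let τ > 0 and let f : ℝ → ℝ be τ-periodic, of bounded variation on [−τ, 0], continuous from the right, and not identically zero. Then the multiplication map U : Y → Y, (Uφ)(θ) = f(θ)φ(θ), is not a compact operator: there exists a sequence (φ_n) in Y whose total variations on [−τ, 0] are all at most 1, such that no subsequence of (f·φ_n) is Cauchy with respect to the total variation distance d(ψ₁, ψ₂) = total variation of ψ₁ − ψ₂ on [−τ, 0]. -/
/-- The right-continuous unit step, from `-1` up to `0`, with its jump at `p`. -/
noncomputable def unitStep (p θ : ℝ) : ℝ := if θ < p then -1 else 0

theorem monotone_unitStep (p : ℝ) : Monotone (unitStep p) := by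
  intro x y hxy
  unfold unitStep
  split_ifs <;> linarith

theorem continuousWithinAt_unitStep (p θ : ℝ) :
    ContinuousWithinAt (unitStep p) (Set.Ici θ) θ := by
  rcases lt_or_ge θ p with h | h
  · have hev : unitStep p =ᶠ[nhds θ] fun _ => -1 := by
      filter_upwards [Iio_mem_nhds h] with x hx
      exact if_pos hx
    exact (continuousAt_const.congr hev.symm).continuousWithinAt
  · exact continuousWithinAt_const.congr (fun x hx => if_neg (not_lt.2 (h.trans hx)))
      (if_neg (not_lt.2 h))

theorem eVariationOn_unitStep_le (p a b : ℝ) :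
    eVariationOn (unitStep p) (Set.Icc a b) ≤ 1 := by
  have h := ((monotone_unitStep p).monotoneOn Set.univ).eVariationOn_eq
    (Set.mem_univ a) (Set.mem_univ b)
  rw [Set.univ_inter] at h
  rw [h, ← ENNReal.ofReal_one]
  apply ENNReal.ofReal_le_ofReal
  unfold unitStep
  split_ifs <;> norm_num

theorem memY_unitStep {p : ℝ} (τ : ℝ) (hp : p ≤ 0) : memY τ (unitStep p) :=
  ⟨((eVariationOn_unitStep_le p (-τ) 0).trans_lt ENNReal.one_lt_top).ne,
    fun θ _ => continuousWithinAt_unitStep p θ, if_neg (not_lt.2 hp)⟩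

/-- Multiplying the difference of two steps by `f` leaves variation at least `|f p|`, where `p`
is the location of the earlier jump. -/
theorem ofReal_abs_le_eVariationOn_mul_unitStep_sub {a b p q : ℝ} (f : ℝ → ℝ)
    (hap : a ≤ p) (hpq : p < q) (hqb : q ≤ b) :
    ENNReal.ofReal |f p| ≤
      eVariationOn (fun θ => f θ * unitStep q θ - f θ * unitStep p θ) (Set.Icc a b) := by
  refine le_trans (le_of_eq ?_) (eVariationOn.edist_le _ (x := p) (y := q)
    ⟨hap, hpq.le.trans hqb⟩ ⟨hap.trans hpq.le, hqb⟩)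
  simp [edist_dist, unitStep, hpq, hpq.not_gt]

/-- If `f` is not identically zero, the multiplication operator
`U : φ ↦ f·φ` on `Y` is not compact: there is a sequence in the unit ball of
`Y` whose image under `U` has no Cauchy subsequence for the total variation
distance. -/
theorem multiplication_operator_not_compact
    (τ : ℝ) (hτ : 0 < τ) (f : ℝ → ℝ) (hf : Function.Periodic f τ)
    (hbv : BoundedVariationOn f (Set.Icc (-τ) 0))
    (hrc : ∀ θ ∈ Set.Ico (-τ) 0, ContinuousWithinAt f (Set.Ici θ) θ)
    (hfne : ∃ t : ℝ, f t ≠ 0) :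
    ∃ φ : ℕ → (ℝ → ℝ),
      (∀ n, memY τ (φ n)) ∧
      (∀ n, eVariationOn (φ n) (Set.Icc (-τ) 0) ≤ 1) ∧
      ∀ s : ℕ → ℕ, StrictMono s →
        ¬ (∀ ε : ℝ, 0 < ε → ∃ N : ℕ, ∀ m n : ℕ, N ≤ m → N ≤ n →
            eVariationOn (fun θ => f θ * φ (s m) θ - f θ * φ (s n) θ)
              (Set.Icc (-τ) 0) < ENNReal.ofReal ε) := by
  obtain ⟨t, ht⟩ := hfne
  obtain ⟨x, hx, hxt⟩ := hf.exists_mem_Ico hτ t (-τ)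
  rw [neg_add_cancel] at hx
  have hfx : 0 < |f x| := abs_pos.2 (hxt ▸ ht)
  have hlarge : ∀ᶠ y in nhdsWithin x (Set.Ici x), |f x| / 2 < |f y| :=
    (hrc x hx).abs.eventually (lt_mem_nhds (half_lt_self hfx))
  obtain ⟨d, hd, hsub⟩ := (mem_nhdsGE_iff_exists_Ico_subset' hx.2).1 hlarge
  obtain ⟨p, hp_anti, hp_mem, -⟩ := exists_seq_strictAnti_tendsto' (lt_min hd hx.2)
  have hp : ∀ n, x < p n ∧ p n < d ∧ p n < 0 := fun n =>
    ⟨(hp_mem n).1, lt_min_iff.1 (hp_mem n).2⟩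
  refine ⟨fun n => unitStep (p n), fun n => memY_unitStep τ (hp n).2.2.le,
    fun n => eVariationOn_unitStep_le _ _ _, fun s hs hC => ?_⟩
  obtain ⟨N, hN⟩ := hC (|f x| / 2) (half_pos hfx)
  have hsep := ofReal_abs_le_eVariationOn_mul_unitStep_sub f
    (hx.1.trans (hp (s (N + 1))).1.le) (hp_anti (hs N.lt_succ_self)) (hp (s N)).2.2.le
  have hval : |f x| / 2 < |f (p (s (N + 1)))| :=
    hsub ⟨(hp _).1.le, (hp _).2.1⟩
  exact absurd (hsep.trans_lt (hN N (N + 1) le_rfl N.le_succ))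
    (not_lt.2 (ENNReal.ofReal_le_ofReal hval.le))
end

section
/- Let τ > 0, let a, b : ℝ → ℝ be τ-periodic, of bounded variation on [−τ, 0] and continuous from the right, and let λ = α + iβ ∈ ℂ with α, β ∈ ℝ. For θ ∈ [−τ/2, 0] define the real 4×4 matrix M(θ) with rows (a(θ)a(θ+τ/2) + b(θ) − α, β, a(θ)b(θ+τ/2), 0), (−β, a(θ)a(θ+τ/2) + b(θ) − α, 0, a(θ)b(θ+τ/2)), (a(θ−τ/2), 0, b(θ−τ/2) − α, β), and (0, a(θ−τ/2), −β, b(θ−τ/2) − α). Then the map Y_ℂ → Y_ℂ, φ ↦ Uφ − λφ, is bijective if and only if there exists c > 0 such that |det M(θ)| ≥ c for all θ ∈ [−τ/2, 0]. -/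
/-- The monodromy operator of the two-delay neutral renewal equation
`x t = a t * x (t - τ/2) + b t * x (t - τ)` acting on `Y_ℂ`. -/
noncomputable def twoDelayU (τ : ℝ) (a b : ℝ → ℝ) (φ : ℝ → ℂ) : ℝ → ℂ :=
  fun θ =>
    if -(τ / 2) ≤ θ ∧ θ < 0 then
      (a θ : ℂ) * ((a (θ + τ / 2) : ℂ) * φ θ + (b (θ + τ / 2) : ℂ) * φ (θ - τ / 2))
        + (b θ : ℂ) * φ θ
    else if -τ ≤ θ ∧ θ < -(τ / 2) then
      (a θ : ℂ) * φ (θ + τ / 2) + (b θ : ℂ) * φ θ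
    else 0

/-- The real `4×4` matrix associated to `U_ℂ - λ I` for the two-delay equation. -/
noncomputable def twoDelayMatrix (τ : ℝ) (a b : ℝ → ℝ) (α β θ : ℝ) :
    Matrix (Fin 4) (Fin 4) ℝ :=
  !![a θ * a (θ + τ / 2) + b θ - α, β, a θ * b (θ + τ / 2), 0;
     -β, a θ * a (θ + τ / 2) + b θ - α, 0, a θ * b (θ + τ / 2);
     a (θ - τ / 2), 0, b (θ - τ / 2) - α, β;
     0, a (θ - τ / 2), -β, b (θ - τ / 2) - α]

open Set Filter Topology

section BoundedVariation

variable {E : Type*} [NormedAddCommGroup E] {f g : ℝ → E} {s : Set ℝ}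

theorem BoundedVariationOn.fun_add (hf : BoundedVariationOn f s) (hg : BoundedVariationOn g s) :
    BoundedVariationOn (fun t => f t + g t) s := by
  refine ne_top_of_le_ne_top (ENNReal.add_ne_top.2 ⟨hf, hg⟩) (iSup_le ?_)
  rintro ⟨n, u, hu, us⟩
  calc ∑ i ∈ Finset.range n, edist (f (u (i + 1)) + g (u (i + 1))) (f (u i) + g (u i))
      ≤ ∑ i ∈ Finset.range n,
          (edist (f (u (i + 1))) (f (u i)) + edist (g (u (i + 1))) (g (u i))) :=
        Finset.sum_le_sum fun i _ => edist_add_add_le _ _ _ _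
    _ ≤ eVariationOn f s + eVariationOn g s := by
        rw [Finset.sum_add_distrib]
        exact add_le_add (eVariationOn.sum_le hu us) (eVariationOn.sum_le hu us)

theorem BoundedVariationOn.fun_neg (hf : BoundedVariationOn f s) :
    BoundedVariationOn (fun t => -f t) s :=
  (LipschitzWith.id.neg (f := fun z : E => z)).comp_boundedVariationOn hf

theorem BoundedVariationOn.const (c : E) (s : Set ℝ) : BoundedVariationOn (fun _ => c) s := by
  have h : eVariationOn (fun _ : ℝ => c) s = 0 :=
    eVariationOn.constant_on (subsingleton_singleton.anti (image_subset_iff.2 fun _ _ => rfl))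
  simp [BoundedVariationOn, h]

theorem BoundedVariationOn.comp_monotone {t : Set ℝ} {u : ℝ → ℝ} (hf : BoundedVariationOn f t)
    (hu : Monotone u) (hst : MapsTo u s t) : BoundedVariationOn (fun x => f (u x)) s :=
  ne_top_of_le_ne_top hf (eVariationOn.comp_le_of_monotoneOn f u (hu.monotoneOn s) hst)

theorem BoundedVariationOn.ite_lt [NormedSpace ℝ E] {x c y : ℝ}
    (hxc : x ≤ c) (hcy : c ≤ y) (hf : BoundedVariationOn f (Icc x c))
    (hg : BoundedVariationOn g (Icc c y)) :
    BoundedVariationOn (fun t => if t < c then f t else g t) (Icc x y) := by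
  have hχ : BoundedVariationOn (fun t : ℝ => if t < c then (0 : ℝ) else 1) (Icc x y) := by
    refine MonotoneOn.boundedVariationOn (C := 1) ?_ ?_
    · intro t _ u _ htu
      dsimp only
      split_ifs <;> linarith
    · intro t _
      split_ifs <;> simp
  have hf' : BoundedVariationOn (fun t => f (min t c)) (Icc x y) :=
    hf.comp_monotone (fun _ _ h => min_le_min_right c h)
      fun t ht => ⟨le_min ht.1 hxc, min_le_right _ _⟩
  have hg' : BoundedVariationOn (fun t => g (max t c)) (Icc x y) :=
    hg.comp_monotone (fun _ _ h => max_le_max_right c h)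
      fun t ht => ⟨le_max_right _ _, max_le ht.2 hcy⟩
  have key := hf'.fun_add (hχ.fun_smul (hg'.fun_add hf'.fun_neg))
  convert key using 2 with t
  split_ifs with h
  · simp [min_eq_left h.le]
  · simp [max_eq_left (not_lt.1 h)]

end BoundedVariation

/-- Functions of bounded variation on `[x, y]` that are right-continuous on `[x, y)`. -/
def IsRightContBV (x y : ℝ) (f : ℝ → ℂ) : Prop :=
  BoundedVariationOn f (Icc x y) ∧ ∀ t ∈ Ico x y, ContinuousWithinAt f (Ici t) t

namespace IsRightContBV

variable {x y : ℝ} {f g : ℝ → ℂ}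

theorem const (x y : ℝ) (c : ℂ) : IsRightContBV x y (fun _ => c) :=
  ⟨.const c _, fun _ _ => continuousWithinAt_const⟩

theorem add (hf : IsRightContBV x y f) (hg : IsRightContBV x y g) :
    IsRightContBV x y (fun t => f t + g t) :=
  ⟨hf.1.fun_add hg.1, fun t ht => (hf.2 t ht).add (hg.2 t ht)⟩

theorem neg (hf : IsRightContBV x y f) : IsRightContBV x y (fun t => -f t) :=
  ⟨hf.1.fun_neg, fun t ht => (hf.2 t ht).neg⟩

theorem sub (hf : IsRightContBV x y f) (hg : IsRightContBV x y g) :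
    IsRightContBV x y (fun t => f t - g t) := by
  simpa only [sub_eq_add_neg] using hf.add hg.neg

theorem mul (hf : IsRightContBV x y f) (hg : IsRightContBV x y g) :
    IsRightContBV x y (fun t => f t * g t) :=
  ⟨hf.1.fun_smul hg.1, fun t ht => (hf.2 t ht).mul (hg.2 t ht)⟩

theorem inv (hf : IsRightContBV x y f) {c : ℝ} (hc : 0 < c) (hfc : ∀ t ∈ Icc x y, c ≤ ‖f t‖) :
    IsRightContBV x y (fun t => (f t)⁻¹) := by
  constructor
  · have hL : LipschitzOnWith (Real.toNNReal (c * c)⁻¹) (fun z : ℂ => z⁻¹) {z | c ≤ ‖z‖} := by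
      refine LipschitzOnWith.of_dist_le_mul fun z hz w hw => ?_
      have hz' : c ≤ ‖z‖ := hz
      have hw' : c ≤ ‖w‖ := hw
      rw [dist_inv_inv₀ (norm_pos_iff.1 (hc.trans_le hz')) (norm_pos_iff.1 (hc.trans_le hw')),
        Real.coe_toNNReal _ (by positivity), div_eq_inv_mul]
      gcongr
    exact hL.comp_boundedVariationOn hfc hf.1
  · intro t ht
    exact (hf.2 t ht).inv₀ (norm_pos_iff.1 (hc.trans_le (hfc t (Ico_subset_Icc_self ht))))

theorem comp_add_const (hf : IsRightContBV x y f) (d : ℝ) :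
    IsRightContBV (x - d) (y - d) (fun t => f (t + d)) := by
  constructor
  · exact hf.1.comp_monotone (fun _ _ h => by simpa using h)
      fun t ht => ⟨by linarith [ht.1], by linarith [ht.2]⟩
  · intro t ht
    have h := hf.2 (t + d) ⟨by linarith [ht.1], by linarith [ht.2]⟩
    exact ContinuousWithinAt.comp (f := fun t => t + d) h
      (continuous_id.add continuous_const).continuousWithinAt
      fun u hu => by simpa using hu

theorem mono (hf : IsRightContBV x y f) {x' y' : ℝ} (hx : x ≤ x') (hy : y' ≤ y) :
    IsRightContBV x' y' f :=
  ⟨hf.1.mono (Icc_subset_Icc hx hy), fun t ht => hf.2 t ⟨hx.trans ht.1, ht.2.trans_le hy⟩⟩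

theorem ite_lt {c : ℝ} (hxc : x ≤ c) (hcy : c ≤ y) (hf : IsRightContBV x c f)
    (hg : IsRightContBV c y g) : IsRightContBV x y (fun t => if t < c then f t else g t) := by
  refine ⟨hf.1.ite_lt hxc hcy hg.1, fun t ht => ?_⟩
  rcases lt_or_ge t c with h | h
  · refine (hf.2 t ⟨ht.1, h⟩).congr_of_eventuallyEq ?_ (if_pos h)
    filter_upwards [Ico_mem_nhdsGE h] with u hu using if_pos hu.2
  · exact (hg.2 t ⟨h, ht.2⟩).congr (fun u hu => if_neg (not_lt.2 (h.trans hu)))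
      (if_neg (not_lt.2 h))

theorem ofReal {r : ℝ → ℝ} (hr : BoundedVariationOn r (Icc x y))
    (hc : ∀ t ∈ Ico x y, ContinuousWithinAt r (Ici t) t) :
    IsRightContBV x y (fun t => (r t : ℂ)) :=
  ⟨Complex.isometry_ofReal.lipschitz.comp_boundedVariationOn hr,
    fun t ht => Complex.continuous_ofReal.continuousAt.comp_continuousWithinAt (hc t ht)⟩

theorem exists_norm_le (hf : IsRightContBV x y f) (hxy : x ≤ y) :
    ∃ K, ∀ t ∈ Icc x y, ‖f t‖ ≤ K := by
  refine ⟨‖f x‖ + (eVariationOn f (Icc x y)).toReal, fun t ht => ?_⟩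
  have h := hf.1.dist_le ht (left_mem_Icc.2 hxy)
  rw [dist_eq_norm] at h
  linarith [norm_le_norm_add_norm_sub' (f t) (f x)]

end IsRightContBV

theorem memYC_iff {τ : ℝ} {φ : ℝ → ℂ} : memYC τ φ ↔ IsRightContBV (-τ) 0 φ ∧ φ 0 = 0 :=
  and_assoc.symm

theorem Function.Periodic.apply_add_half {X : Type*} {f : ℝ → X} {τ : ℝ}
    (hf : Function.Periodic f τ) (θ : ℝ) : f (θ + τ / 2) = f (θ - τ / 2) := by
  rw [← hf (θ - τ / 2)]
  congr 1
  ring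

section TwoDelay

variable {τ : ℝ} {a b : ℝ → ℝ}

/-- The determinant of the complex `2×2` matrix representing `U - λ I` fibrewise. -/
noncomputable def twoDelayDet (τ : ℝ) (a b : ℝ → ℝ) (lam : ℂ) (θ : ℝ) : ℂ :=
  ((b θ : ℂ) - lam) * ((b (θ - τ / 2) : ℂ) - lam) - lam * ((a θ : ℂ) * (a (θ - τ / 2) : ℂ))

theorem twoDelayMatrix_det (ha : Function.Periodic a τ) (hb : Function.Periodic b τ)
    (α β θ : ℝ) :
    (twoDelayMatrix τ a b α β θ).det = ‖twoDelayDet τ a b ⟨α, β⟩ θ‖ ^ 2 := by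
  rw [← Complex.normSq_eq_norm_sq, Complex.normSq_apply]
  simp only [twoDelayMatrix, ha.apply_add_half, hb.apply_add_half, twoDelayDet]
  simp [Matrix.det_succ_row_zero, Fin.sum_univ_succ, Fin.succAbove]
  ring

theorem twoDelayDet_zero (ha : Function.Periodic a τ) (hb : Function.Periodic b τ) (lam : ℂ) :
    twoDelayDet τ a b lam 0 = twoDelayDet τ a b lam (-(τ / 2)) := by
  have h : -(τ / 2) - τ / 2 = 0 - τ := by ring
  simp only [twoDelayDet, h, ha.sub_eq, hb.sub_eq]
  simp only [zero_sub]
  ring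

theorem twoDelayU_upper (ha : Function.Periodic a τ) (hb : Function.Periodic b τ) (φ : ℝ → ℂ)
    {θ : ℝ} (hθ : θ ∈ Ico (-(τ / 2)) 0) :
    twoDelayU τ a b φ θ =
      (a θ : ℂ) * ((a (θ - τ / 2) : ℂ) * φ θ + (b (θ - τ / 2) : ℂ) * φ (θ - τ / 2))
        + (b θ : ℂ) * φ θ := by
  have h : -(τ / 2) ≤ θ ∧ θ < 0 := hθ
  simp only [twoDelayU, if_pos h, ha.apply_add_half, hb.apply_add_half]

theorem twoDelayU_lower (φ : ℝ → ℂ) {θ : ℝ} (hθ : θ ∈ Ico (-(τ / 2)) 0) :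
    twoDelayU τ a b φ (θ - τ / 2) =
      (a (θ - τ / 2) : ℂ) * φ θ + (b (θ - τ / 2) : ℂ) * φ (θ - τ / 2) := by
  have h₁ : ¬(-(τ / 2) ≤ θ - τ / 2 ∧ θ - τ / 2 < 0) := fun h => by linarith [h.1, hθ.2]
  have h₂ : -τ ≤ θ - τ / 2 ∧ θ - τ / 2 < -(τ / 2) :=
    ⟨by linarith [hθ.1], by linarith [hθ.2]⟩
  simp only [twoDelayU, if_neg h₁, if_pos h₂, sub_add_cancel]

theorem twoDelayU_zero (hτ : 0 < τ) (φ : ℝ → ℂ) : twoDelayU τ a b φ 0 = 0 := by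
  have h : ¬(0 < -(τ / 2)) := by linarith
  simp [twoDelayU, h]

/-- A property of the points of `[-τ, 0]` may be checked at `0` and on the pairs
`θ, θ - τ/2` with `θ ∈ [-τ/2, 0)`. -/
theorem forall_Icc_of_forall_Ico_half {p : ℝ → Prop} (h0 : p 0)
    (h : ∀ θ ∈ Ico (-(τ / 2)) 0, p θ ∧ p (θ - τ / 2)) : ∀ θ ∈ Icc (-τ) 0, p θ := by
  intro θ hθ
  rcases hθ.2.eq_or_lt with rfl | h₀
  · exact h0
  rcases le_or_gt (-(τ / 2)) θ with h₁ | h₁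
  · exact (h θ ⟨h₁, h₀⟩).1
  · have := (h (θ + τ / 2) ⟨by linarith [hθ.1], by linarith⟩).2
    rwa [add_sub_cancel_right] at this

theorem exists_norm_twoDelayDet_ge_of_surjective (hτ : 0 < τ)
    (ha : Function.Periodic a τ) (hb : Function.Periodic b τ) {lam : ℂ}
    (hsurj : ∀ ψ : ℝ → ℂ, memYC τ ψ → ∃ φ : ℝ → ℂ, memYC τ φ ∧
      ∀ θ ∈ Icc (-τ) 0, twoDelayU τ a b φ θ - lam * φ θ = ψ θ) :
    ∃ c : ℝ, 0 < c ∧ ∀ θ ∈ Icc (-(τ / 2)) 0, c ≤ ‖twoDelayDet τ a b lam θ‖ := by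
  have hmem : ∀ v w : ℂ, memYC τ fun t => if t < -(τ / 2) then v else if t < 0 then w else 0 := by
    intro v w
    refine memYC_iff.2 ⟨.ite_lt (by linarith) (by linarith) (.const _ _ v)
      (.ite_lt (by linarith) le_rfl (.const _ _ w) (.const _ _ 0)), ?_⟩
    have h : ¬(0 < -(τ / 2)) := by linarith
    simp [h]
  obtain ⟨φ₁, hφ₁, h₁⟩ := hsurj _ (hmem 0 1)
  obtain ⟨φ₂, hφ₂, h₂⟩ := hsurj _ (hmem 1 0)
  obtain ⟨K₁, hK₁⟩ := (memYC_iff.1 hφ₁).1.exists_norm_le (by linarith)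
  obtain ⟨K₂, hK₂⟩ := (memYC_iff.1 hφ₂).1.exists_norm_le (by linarith)
  have hK₁0 : 0 ≤ K₁ := (norm_nonneg _).trans (hK₁ 0 ⟨by linarith, le_rfl⟩)
  have hK₂0 : 0 ≤ K₂ := (norm_nonneg _).trans (hK₂ 0 ⟨by linarith, le_rfl⟩)
  have hbound : ∀ θ ∈ Ico (-(τ / 2)) 0,
      (2 * K₁ * K₂ + 1)⁻¹ ≤ ‖twoDelayDet τ a b lam θ‖ := by
    intro θ hθ
    have hu : θ ∈ Icc (-τ) 0 := ⟨by linarith [hθ.1], hθ.2.le⟩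
    have hl : θ - τ / 2 ∈ Icc (-τ) 0 := ⟨by linarith [hθ.1], by linarith [hθ.2]⟩
    have hlt : θ - τ / 2 < -(τ / 2) := by linarith [hθ.2]
    have e₁ := h₁ θ hu
    have e₂ := h₁ _ hl
    have e₃ := h₂ θ hu
    have e₄ := h₂ _ hl
    rw [twoDelayU_upper ha hb _ hθ, if_neg (not_lt.2 hθ.1), if_pos hθ.2] at e₁ e₃
    rw [twoDelayU_lower _ hθ, if_pos hlt] at e₂ e₄
    have key : twoDelayDet τ a b lam θ *
        (φ₁ θ * φ₂ (θ - τ / 2) - φ₂ θ * φ₁ (θ - τ / 2)) = 1 := by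
      unfold twoDelayDet
      generalize φ₁ θ = x₁ at *
      generalize φ₁ (θ - τ / 2) = y₁ at *
      generalize φ₂ θ = x₂ at *
      generalize φ₂ (θ - τ / 2) = y₂ at *
      linear_combination ((a (θ - τ / 2) : ℂ) * x₂ + ((b (θ - τ / 2) : ℂ) - lam) * y₂) * e₁
        - ((a (θ - τ / 2) : ℂ) * x₁ + ((b (θ - τ / 2) : ℂ) - lam) * y₁) * e₃ + e₄
    have hnorm := congrArg norm key
    rw [norm_mul, norm_one] at hnorm
    have hX : ‖φ₁ θ * φ₂ (θ - τ / 2) - φ₂ θ * φ₁ (θ - τ / 2)‖ ≤ 2 * K₁ * K₂ + 1 := by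
      calc _ ≤ ‖φ₁ θ‖ * ‖φ₂ (θ - τ / 2)‖ + ‖φ₂ θ‖ * ‖φ₁ (θ - τ / 2)‖ := by
            simpa only [norm_mul] using
              norm_sub_le (φ₁ θ * φ₂ (θ - τ / 2)) (φ₂ θ * φ₁ (θ - τ / 2))
        _ ≤ K₁ * K₂ + K₂ * K₁ := by
            gcongr <;> first | exact hK₁ _ ‹_› | exact hK₂ _ ‹_›
        _ ≤ _ := by linarith
    rw [inv_le_iff_one_le_mul₀' (by positivity), mul_comm]
    exact hnorm.ge.trans (by gcongr)
  refine ⟨(2 * K₁ * K₂ + 1)⁻¹, by positivity, fun θ hθ => ?_⟩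
  rcases hθ.2.eq_or_lt with rfl | h0
  · rw [twoDelayDet_zero ha hb]
    exact hbound _ ⟨le_rfl, by linarith⟩
  · exact hbound θ ⟨hθ.1, h0⟩

theorem eqOn_of_twoDelayDet_ne_zero (hτ : 0 < τ)
    (ha : Function.Periodic a τ) (hb : Function.Periodic b τ) {lam : ℂ}
    (hd : ∀ θ ∈ Icc (-(τ / 2)) 0, twoDelayDet τ a b lam θ ≠ 0) {φ₁ φ₂ : ℝ → ℂ}
    (h₀ : φ₁ 0 = φ₂ 0)
    (h : ∀ θ ∈ Icc (-τ) 0,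
      twoDelayU τ a b φ₁ θ - lam * φ₁ θ = twoDelayU τ a b φ₂ θ - lam * φ₂ θ) :
    ∀ θ ∈ Icc (-τ) 0, φ₁ θ = φ₂ θ := by
  refine forall_Icc_of_forall_Ico_half h₀ fun θ hθ => ?_
  have e₁ := h θ ⟨by linarith [hθ.1], hθ.2.le⟩
  have e₂ := h (θ - τ / 2) ⟨by linarith [hθ.1], by linarith [hθ.2]⟩
  rw [twoDelayU_upper ha hb _ hθ, twoDelayU_upper ha hb _ hθ] at e₁
  rw [twoDelayU_lower _ hθ, twoDelayU_lower _ hθ] at e₂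
  have hdθ := hd θ (Ico_subset_Icc_self hθ)
  constructor <;> refine mul_left_cancel₀ hdθ ?_ <;> unfold twoDelayDet
  · linear_combination ((b (θ - τ / 2) : ℂ) - lam) * e₁
      - (a θ : ℂ) * (b (θ - τ / 2) : ℂ) * e₂
  · linear_combination ((a θ : ℂ) * (a (θ - τ / 2) : ℂ) + (b θ : ℂ) - lam) * e₂
      - (a (θ - τ / 2) : ℂ) * e₁

theorem surjective_of_norm_twoDelayDet_ge (hτ : 0 < τ)
    (ha : Function.Periodic a τ) (hb : Function.Periodic b τ)
    (ha' : IsRightContBV (-τ) 0 fun t => (a t : ℂ))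
    (hb' : IsRightContBV (-τ) 0 fun t => (b t : ℂ)) {lam : ℂ} {c : ℝ} (hc : 0 < c)
    (hd : ∀ θ ∈ Icc (-(τ / 2)) 0, c ≤ ‖twoDelayDet τ a b lam θ‖) {ψ : ℝ → ℂ}
    (hψ : memYC τ ψ) :
    ∃ φ : ℝ → ℂ, memYC τ φ ∧
      ∀ θ ∈ Icc (-τ) 0, twoDelayU τ a b φ θ - lam * φ θ = ψ θ := by
  obtain ⟨hψ', hψ0⟩ := memYC_iff.1 hψ
  have upper : ∀ f : ℝ → ℂ, IsRightContBV (-τ) 0 f → IsRightContBV (-(τ / 2)) 0 f :=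
    fun f hf => hf.mono (by linarith) le_rfl
  have lower : ∀ f : ℝ → ℂ, IsRightContBV (-τ) 0 f →
      IsRightContBV (-(τ / 2)) 0 fun t => f (t - τ / 2) := by
    intro f hf
    simpa only [← sub_eq_add_neg] using
      (hf.comp_add_const (-(τ / 2))).mono (x' := -(τ / 2)) (y' := 0) (by linarith) (by linarith)
  have hlam : IsRightContBV (-(τ / 2)) 0 fun _ => lam := .const _ _ lam
  have ha₁ := upper _ ha'
  have ha₂ := lower _ ha'
  have hb₁ := upper _ hb'
  have hb₂ := lower _ hb'
  have hψ₁ := upper _ hψ'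
  have hψ₂ := lower _ hψ'
  have hdet : IsRightContBV (-(τ / 2)) 0 (twoDelayDet τ a b lam) := by
    unfold twoDelayDet
    exact ((hb₁.sub hlam).mul (hb₂.sub hlam)).sub (hlam.mul (ha₁.mul ha₂))
  have hinv := hdet.inv hc hd
  obtain ⟨R, hR, hRdef⟩ : ∃ R, IsRightContBV (-(τ / 2)) 0 R ∧
      ∀ t, R t = (((b (t - τ / 2) : ℂ) - lam) * ψ t
        - (a t : ℂ) * (b (t - τ / 2) : ℂ) * ψ (t - τ / 2)) * (twoDelayDet τ a b lam t)⁻¹ :=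
    ⟨_, (((hb₂.sub hlam).mul hψ₁).sub ((ha₁.mul hb₂).mul hψ₂)).mul hinv, fun _ => rfl⟩
  obtain ⟨L, hL, hLdef⟩ : ∃ L, IsRightContBV (-(τ / 2)) 0 L ∧
      ∀ t, L t = (((a t : ℂ) * (a (t - τ / 2) : ℂ) + (b t : ℂ) - lam) * ψ (t - τ / 2)
        - (a (t - τ / 2) : ℂ) * ψ t) * (twoDelayDet τ a b lam t)⁻¹ :=
    ⟨_, (((((ha₁.mul ha₂).add hb₁).sub hlam).mul hψ₂).sub (ha₂.mul hψ₁)).mul hinv, fun _ => rfl⟩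
  have hneg : ¬(0 < -(τ / 2)) := by linarith
  let φ : ℝ → ℂ := fun t => if t < -(τ / 2) then L (t + τ / 2) else if t < 0 then R t else 0
  have hφ0 : φ 0 = 0 := by simp [φ, hneg]
  have hφl : IsRightContBV (-τ) (-(τ / 2)) fun t => L (t + τ / 2) :=
    (hL.comp_add_const (τ / 2)).mono (by linarith) (by linarith)
  have hφu : IsRightContBV (-(τ / 2)) 0 fun t => if t < 0 then R t else 0 :=
    .ite_lt (by linarith) le_rfl hR (.const _ _ 0)
  have hφ : IsRightContBV (-τ) 0 φ := .ite_lt (by linarith) (by linarith) hφl hφu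
  refine ⟨φ, memYC_iff.2 ⟨hφ, hφ0⟩, ?_⟩
  refine forall_Icc_of_forall_Ico_half ?_ fun θ hθ => ?_
  · rw [twoDelayU_zero hτ, hφ0, hψ0, mul_zero, sub_zero]
  have hne : twoDelayDet τ a b lam θ ≠ 0 :=
    norm_pos_iff.1 (hc.trans_le (hd θ (Ico_subset_Icc_self hθ)))
  have hlt : θ - τ / 2 < -(τ / 2) := by linarith [hθ.2]
  have hφu : φ θ = R θ := by simp only [φ, if_neg (not_lt.2 hθ.1), if_pos hθ.2]
  have hφl : φ (θ - τ / 2) = L θ := by simp only [φ, if_pos hlt, sub_add_cancel]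
  rw [twoDelayU_upper ha hb _ hθ, twoDelayU_lower _ hθ, hφu, hφl]
  have hmul : twoDelayDet τ a b lam θ * (twoDelayDet τ a b lam θ)⁻¹ = 1 := mul_inv_cancel₀ hne
  rw [hRdef, hLdef]
  generalize (twoDelayDet τ a b lam θ)⁻¹ = i at hmul ⊢
  unfold twoDelayDet at hmul
  constructor
  · linear_combination ψ θ * hmul
  · linear_combination ψ (θ - τ / 2) * hmul

end TwoDelay

/-- `U_ℂ - λ I` is bijective on `Y_ℂ` (surjective and injective,
modulo agreement on `[-τ, 0]`) if and only if the determinant of the associated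
`4×4` matrix is bounded away from `0` on `[-τ/2, 0]`. -/
theorem two_delay_bijective_iff_det_bounded_away
    (τ : ℝ) (hτ : 0 < τ) (a b : ℝ → ℝ)
    (ha : Function.Periodic a τ) (hb : Function.Periodic b τ)
    (habv : BoundedVariationOn a (Set.Icc (-τ) 0))
    (hbbv : BoundedVariationOn b (Set.Icc (-τ) 0))
    (harc : ∀ θ ∈ Set.Ico (-τ) 0, ContinuousWithinAt a (Set.Ici θ) θ)
    (hbrc : ∀ θ ∈ Set.Ico (-τ) 0, ContinuousWithinAt b (Set.Ici θ) θ)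
    (α β : ℝ) (lam : ℂ) (hlam : lam = Complex.mk α β) :
    ((∀ ψ : ℝ → ℂ, memYC τ ψ →
        ∃ φ : ℝ → ℂ, memYC τ φ ∧
          ∀ θ ∈ Set.Icc (-τ) 0, twoDelayU τ a b φ θ - lam * φ θ = ψ θ) ∧
     (∀ φ₁ φ₂ : ℝ → ℂ, memYC τ φ₁ → memYC τ φ₂ →
        (∀ θ ∈ Set.Icc (-τ) 0,
          twoDelayU τ a b φ₁ θ - lam * φ₁ θ = twoDelayU τ a b φ₂ θ - lam * φ₂ θ) →
        ∀ θ ∈ Set.Icc (-τ) 0, φ₁ θ = φ₂ θ)) ↔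
    (∃ c : ℝ, 0 < c ∧ ∀ θ ∈ Set.Icc (-(τ / 2)) 0,
      c ≤ |(twoDelayMatrix τ a b α β θ).det|) := by
  subst hlam
  simp only [twoDelayMatrix_det ha hb, abs_pow, abs_norm]
  have ha' := IsRightContBV.ofReal habv harc
  have hb' := IsRightContBV.ofReal hbbv hbrc
  constructor
  · rintro ⟨hsurj, -⟩
    obtain ⟨c, hc, h⟩ := exists_norm_twoDelayDet_ge_of_surjective hτ ha hb hsurj
    exact ⟨c ^ 2, by positivity, fun θ hθ => pow_le_pow_left₀ hc.le (h θ hθ) 2⟩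
  · rintro ⟨c, hc, h⟩
    have hd : ∀ θ ∈ Icc (-(τ / 2)) 0, √c ≤ ‖twoDelayDet τ a b ⟨α, β⟩ θ‖ :=
      fun θ hθ => Real.sqrt_le_iff.2 ⟨norm_nonneg _, h θ hθ⟩
    have hc' : 0 < √c := Real.sqrt_pos.2 hc
    exact ⟨fun ψ hψ => surjective_of_norm_twoDelayDet_ge hτ ha hb ha' hb' hc' hd hψ,
      fun φ₁ φ₂ h₁ h₂ => eqOn_of_twoDelayDet_ne_zero hτ ha hb
        (fun θ hθ => norm_pos_iff.1 (hc'.trans_le (hd θ hθ))) (h₁.2.2.trans h₂.2.2.symm)⟩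
end

section
/- Let τ > 0 and let a, b ∈ ℝ be constants with a⁴ + 4a²b ≥ 0, and set λ = (a² + 2b + √(a⁴ + 4a²b))/2 or λ = (a² + 2b − √(a⁴ + 4a²b))/2. Then λ is an eigenvalue of the monodromy operator of the two-delay neutral renewal equation x(t) = a x(t − τ/2) + b x(t − τ): there exists φ ∈ Y, not identically zero on [−τ, 0], such that for all θ ∈ [−τ/2, 0) both (a² + b) φ(θ) + a b φ(θ − τ/2) = λ φ(θ) and a φ(θ) + b φ(θ − τ/2) = λ φ(θ − τ/2) hold. -/
/-- The function equal to `v` on `(-∞, c)`, to `u` on `[c, d)` and to `0` on `[d, ∞)`. -/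
noncomputable def twoStep (c d u v x : ℝ) : ℝ :=
  if x < c then v else if x < d then u else 0

theorem boundedVariationOn_twoStep (c d u v : ℝ) (s : Set ℝ) :
    BoundedVariationOn (twoStep c d u v) s := by
  let g : ℝ → Fin 3 := fun x => if x < c then 0 else if x < d then 1 else 2
  have hg : Monotone g := by
    intro x y hxy
    simp only [g]
    split_ifs <;> first | decide | (exfalso; linarith)
  have hfg : twoStep c d u v = ![v, u, 0] ∘ g := by
    funext x
    simp only [g, twoStep, Function.comp]
    split_ifs <;> rfl
  rw [hfg]
  exact ne_top_of_le_ne_top (BoundedVariationOn.of_finite _ Set.univ)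
    (eVariationOn.comp_le_of_monotoneOn _ g (hg.monotoneOn s) (Set.mapsTo_univ g s))

theorem continuousWithinAt_Ici_ite_lt {f g : ℝ → ℝ} {c x : ℝ}
    (hf : ContinuousWithinAt f (Set.Ici x) x) (hg : ContinuousWithinAt g (Set.Ici x) x) :
    ContinuousWithinAt (fun y => if y < c then f y else g y) (Set.Ici x) x := by
  rcases lt_or_ge x c with h | h
  · refine hf.congr_of_eventuallyEq_of_mem ?_ Set.self_mem_Ici
    filter_upwards [mem_nhdsWithin_of_mem_nhds (Iio_mem_nhds h)] with y hy
    exact if_pos hy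
  · refine hg.congr_of_eventuallyEq_of_mem ?_ Set.self_mem_Ici
    filter_upwards [self_mem_nhdsWithin] with y hy
    exact if_neg (h.trans hy).not_gt

theorem continuousWithinAt_twoStep (c d u v x : ℝ) :
    ContinuousWithinAt (twoStep c d u v) (Set.Ici x) x :=
  continuousWithinAt_Ici_ite_lt continuousWithinAt_const
    (continuousWithinAt_Ici_ite_lt continuousWithinAt_const continuousWithinAt_const)

/-- A root of the characteristic polynomial of `!![a ^ 2 + b, a * b; a, b]` has an eigenvector. -/
theorem exists_eigenvector_of_charpoly_root {a b l : ℝ}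
    (hl : l ^ 2 - (a ^ 2 + 2 * b) * l + b ^ 2 = 0) :
    ∃ u v : ℝ, (u ≠ 0 ∨ v ≠ 0) ∧
      (a ^ 2 + b) * u + a * b * v = l * u ∧ a * u + b * v = l * v := by
  by_cases ha : a = 0
  · subst ha
    have hlb : l = b := by
      have : (l - b) ^ 2 = 0 := by linear_combination hl
      exact sub_eq_zero.mp (pow_eq_zero_iff two_ne_zero |>.mp this)
    exact ⟨1, 1, Or.inl one_ne_zero, by simp [hlb], by simp [hlb]⟩
  · exact ⟨l - b, a, Or.inr ha, by linear_combination -hl, by ring⟩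

/-- For constant coefficients `a`, `b` with `a⁴ + 4a²b ≥ 0`, the
numbers `(a² + 2b ± √(a⁴ + 4a²b))/2` are eigenvalues of the monodromy operator
of `x t = a * x (t - τ/2) + b * x (t - τ)`. -/
theorem two_delay_constant_eigenvalues
    (τ : ℝ) (hτ : 0 < τ) (a b : ℝ) (hab : 0 ≤ a ^ 4 + 4 * a ^ 2 * b)
    (lam : ℝ)
    (hlam : lam = (a ^ 2 + 2 * b + Real.sqrt (a ^ 4 + 4 * a ^ 2 * b)) / 2 ∨
            lam = (a ^ 2 + 2 * b - Real.sqrt (a ^ 4 + 4 * a ^ 2 * b)) / 2) :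
    ∃ φ : ℝ → ℝ, memY τ φ ∧ (∃ θ ∈ Set.Icc (-τ) 0, φ θ ≠ 0) ∧
      ∀ θ ∈ Set.Ico (-(τ / 2)) 0,
        (a ^ 2 + b) * φ θ + a * b * φ (θ - τ / 2) = lam * φ θ ∧
        a * φ θ + b * φ (θ - τ / 2) = lam * φ (θ - τ / 2) := by
  have hs := Real.sq_sqrt hab
  have hl : lam ^ 2 - (a ^ 2 + 2 * b) * lam + b ^ 2 = 0 := by
    rcases hlam with rfl | rfl <;> linear_combination hs / 4
  obtain ⟨u, v, huv, h₁, h₂⟩ := exists_eigenvector_of_charpoly_root hl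
  have hu : ∀ θ ∈ Set.Ico (-(τ / 2)) 0, twoStep (-(τ / 2)) 0 u v θ = u := fun θ hθ => by
    rw [twoStep, if_neg hθ.1.not_gt, if_pos hθ.2]
  have hv : ∀ θ < -(τ / 2), twoStep (-(τ / 2)) 0 u v θ = v := fun θ hθ => if_pos hθ
  refine ⟨twoStep (-(τ / 2)) 0 u v,
    ⟨boundedVariationOn_twoStep _ _ u v _,
      fun θ _ => continuousWithinAt_twoStep _ _ u v θ, ?_⟩, ?_, fun θ hθ => ?_⟩
  · rw [twoStep, if_neg (by linarith), if_neg (lt_irrefl 0)]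
  · rcases huv with h | h
    · exact ⟨-(τ / 2), ⟨by linarith, by linarith⟩, by
        rwa [hu _ ⟨le_rfl, by linarith⟩]⟩
    · exact ⟨-τ, ⟨le_rfl, by linarith⟩, by rwa [hv _ (by linarith)]⟩
  · rw [hu θ hθ, hv (θ - τ / 2) (by linarith [hθ.2])]
    exact ⟨h₁, h₂⟩
end
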